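/- Let Ω : [0,∞) → (0,∞) be nonincreasing with Ω(t) → 0 as t → ∞ and Ω(t/2) ≤ C₀·Ω(t) for some constant C₀ and all t > 0. Then there exists a compact set E ⊆ ℝ of positive Lebesgue measure such that: (i) there exists a nonzero positive finite Borel measure μ supported in E with ∫_ℝ |μ̂(ξ)|^r dξ < ∞ for every r > 1; and (ii) every finite complex Borel measure ν supported in E with |ν̂(ξ)| ≤ Ω(ξ) for all ξ > 0 is the zero measure. -/

import Mathlib

open MeasureTheory Filter Topology Set

noncomputable section

/-- The Fourier transform at `ξ` of the finite complex Borel measure `g dν`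
on `ℝ`: `μ̂(ξ) = ∫ e^{-2πiξx} g(x) dν(x)`. -/
def cmFT (ν : Measure ℝ) (g : ℝ → ℂ) (ξ : ℝ) : ℂ :=
  ∫ x, Complex.exp (-(((2 * Real.pi * ξ * x : ℝ) : ℂ) * Complex.I)) * g x ∂ν

/-- The Fourier transform at `ξ` of a positive measure `μ` on `ℝ`. -/
def mFT (μ : Measure ℝ) (ξ : ℝ) : ℂ :=
  ∫ x, Complex.exp (-(((2 * Real.pi * ξ * x : ℝ) : ℂ) * Complex.I)) ∂μ

theorem four_mul_dist_le_norm_exp_sub_one {x δ : ℝ} (hx : ∀ k : ℤ, δ ≤ |x - k|) :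
    4 * δ ≤ ‖Complex.exp (-(((2 * Real.pi * x : ℝ) : ℂ) * Complex.I)) - 1‖ := by
  set y : ℝ := x - round x with hy
  have hyb : |y| ≤ 1 / 2 := abs_sub_round x
  have h1 : Complex.exp (-(((2 * Real.pi * x : ℝ) : ℂ) * Complex.I))
      = Complex.exp (Complex.I * ((-(2 * Real.pi * y) : ℝ) : ℂ)) := by
    rw [Complex.exp_eq_exp_iff_exists_int]
    refine ⟨-round x, ?_⟩
    rw [hy]; push_cast; ring
  rw [h1, Complex.norm_exp_I_mul_ofReal_sub_one]
  have h2 : -(2 * Real.pi * y) / 2 = -(Real.pi * y) := by ring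
  rw [h2, Real.sin_neg, norm_mul, norm_neg, Real.norm_eq_abs, Real.norm_eq_abs, abs_two]
  have h3 : 2 / Real.pi * |Real.pi * y| ≤ |Real.sin (Real.pi * y)| := by
    apply Real.mul_abs_le_abs_sin
    rw [abs_mul, abs_of_pos Real.pi_pos]
    nlinarith [Real.pi_pos]
  rw [abs_mul, abs_of_pos Real.pi_pos, ← mul_assoc, div_mul_cancel₀ _ Real.pi_ne_zero] at h3
  have := hx (round x)
  rw [← hy] at this
  linarith

theorem exists_analytic_poly_small {η ε : ℝ} (hη : 0 < η) (hε : 0 < ε) :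
    ∃ (K : ℕ) (c : ℕ → ℂ), c 0 = 1 ∧ ∀ z : ℂ, ‖z‖ = 1 → η ≤ ‖z - 1‖ →
      ‖∑ k ∈ Finset.range (K + 1), c k * z ^ k‖ ≤ ε := by
  obtain ⟨r, hr0, hr1, hrη, hrP⟩ : ∃ r : ℝ, 0 < r ∧ r < 1 ∧ 1 - r ≤ η / 2 ∧
      2 * (1 - r ^ 2) ≤ (η / 2) ^ 2 := by
    refine ⟨max (1 / 2) (1 - min (η / 2) (η ^ 2 / 16)), by positivity, ?_, ?_, ?_⟩
    · have : 0 < min (η / 2) (η ^ 2 / 16) := by positivity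
      exact max_lt (by norm_num) (by linarith)
    · have := le_max_right (1 / 2) (1 - min (η / 2) (η ^ 2 / 16))
      have := min_le_left (η / 2) (η ^ 2 / 16)
      linarith
    · have h1 := le_max_right (1 / 2) (1 - min (η / 2) (η ^ 2 / 16))
      have h2 := min_le_right (η / 2) (η ^ 2 / 16)
      have h3 : max (1 / 2) (1 - min (η / 2) (η ^ 2 / 16)) ≤ 1 :=
        max_le (by norm_num) (by have : 0 < min (η / 2) (η ^ 2 / 16) := by positivity
                                 linarith)
      have h4 : 0 < max (1 / 2) (1 - min (η / 2) (η ^ 2 / 16)) := by positivity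
      nlinarith
  set M : ℝ := 2 * max 0 (-Real.log (ε / 2)) with hM
  let h : ℂ → ℂ := fun z => Complex.exp (M * (2 * r * z / (1 - r * z)))
  have hden : ∀ z : ℂ, ‖z‖ < r⁻¹ → (1 - r * z : ℂ) ≠ 0 := by
    intro z hz h0
    have h1 : (r * z : ℂ) = 1 := (sub_eq_zero.mp h0).symm
    have h2 : ‖(r * z : ℂ)‖ < 1 := by
      rw [norm_mul, Complex.norm_real, Real.norm_eq_abs, abs_of_pos hr0]
      calc r * ‖z‖ < r * r⁻¹ := by gcongr
        _ = 1 := mul_inv_cancel₀ hr0.ne'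
    rw [h1] at h2
    simp at h2
  have hone : 1 < r⁻¹ := (one_lt_inv₀ hr0).2 hr1
  obtain ⟨s, hs1, hs2⟩ := exists_between hone
  obtain ⟨t, ht1, ht2⟩ := exists_between hs1
  have hs0 : 0 < s := by linarith
  lift s to NNReal using hs0.le
  lift t to NNReal using by linarith
  have hd : DifferentiableOn ℂ h (Metric.closedBall 0 s) := by
    intro z hz
    have hz' : ‖z‖ < r⁻¹ := lt_of_le_of_lt (by simpa using hz) hs2
    have := hden z hz'
    apply DifferentiableAt.differentiableWithinAt
    fun_prop (disch := assumption)
  have hp := hd.hasFPowerSeriesOnBall (by exact_mod_cast hs0)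
  have hu := hp.tendstoUniformlyOn (r' := t) (by exact_mod_cast ht2)
  rw [Metric.tendstoUniformlyOn_iff] at hu
  obtain ⟨K, hK⟩ := (hu (ε / 2) (by positivity)).exists_forall_of_atTop
  set p := cauchyPowerSeries h 0 s with hpdef
  refine ⟨K, fun k => p.coeff k, ?_, ?_⟩
  · have := hp.coeff_zero (fun _ => 1)
    calc p.coeff 0 = h 0 := this
      _ = 1 := by simp [h]
  · intro z hz hzη
    have hzb : z ∈ Metric.ball (0 : ℂ) t := by simpa [hz] using ht1
    have h1 := hK (K + 1) (by omega) z hzb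
    have h2 : p.partialSum (K + 1) z = ∑ k ∈ Finset.range (K + 1), p.coeff k * z ^ k := by
      simp [FormalMultilinearSeries.partialSum, mul_comm]
    rw [h2, zero_add] at h1
    have h3 : ‖h z‖ ≤ ε / 2 := by
      have hw := hden z (by rw [hz]; exact hone)
      have hnw : 0 < Complex.normSq (1 - r * z) := Complex.normSq_pos.2 hw
      have hlow : (η / 2) ^ 2 ≤ Complex.normSq (1 - r * z) := by
        rw [Complex.normSq_eq_norm_sq]
        have : ‖z - 1‖ ≤ ‖(1 - r * z : ℂ)‖ + (1 - r) := by
          have e : z - 1 = -((1 - r * z)) + ((1 - r : ℝ) : ℂ) * z := by push_cast; ring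
          rw [e]
          refine (norm_add_le _ _).trans ?_
          rw [norm_neg, norm_mul, hz, Complex.norm_real, Real.norm_eq_abs,
            abs_of_nonneg (by linarith)]
          linarith
        have : η / 2 ≤ ‖(1 - r * z : ℂ)‖ := by linarith
        gcongr
      have hzsq : z.re ^ 2 + z.im ^ 2 = 1 := by
        have := Complex.normSq_eq_norm_sq z
        rw [hz, Complex.normSq_apply] at this
        nlinarith
      have hre : (2 * r * z / (1 - r * z)).re
          = -1 + (1 - r ^ 2) / Complex.normSq (1 - r * z) := by
        rw [Complex.div_re, eq_comm, ← sub_eq_zero]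
        field_simp
        simp [Complex.normSq_apply]
        linear_combination r ^ 2 * hzsq
      simp only [h, Complex.norm_exp]
      rw [Complex.re_ofReal_mul, hre]
      have h5 : (1 - r ^ 2) / Complex.normSq (1 - r * z) ≤ 1 / 2 := by
        rw [div_le_iff₀ hnw]; linarith
      have hM0 : 0 ≤ M := by positivity
      have h6 : M * (-1 + (1 - r ^ 2) / Complex.normSq (1 - r * z)) ≤ Real.log (ε / 2) := by
        have : -Real.log (ε / 2) ≤ max 0 (-Real.log (ε / 2)) := le_max_right _ _
        nlinarith
      calc _ ≤ Real.exp (Real.log (ε / 2)) := Real.exp_le_exp.2 h6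
        _ = ε / 2 := Real.exp_log (by positivity)
    rw [dist_eq_norm] at h1
    have := norm_sub_norm_le (∑ k ∈ Finset.range (K + 1), p.coeff k * z ^ k) (h z)
    rw [norm_sub_rev] at this
    linarith


theorem hasSum_cos_div_sq {y : ℝ} (hy : |y| ≤ 1) :
    HasSum (fun n : ℕ => 1 / (n : ℝ) ^ 2 * Real.cos (2 * Real.pi * n * y))
      (Real.pi ^ 2 * (y ^ 2 - |y| + 1 / 6)) := by
  have h := hasSum_one_div_nat_pow_mul_cos (k := 1) one_ne_zero (x := |y|) ⟨abs_nonneg y, hy⟩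
  convert h using 1
  · funext n
    rcases abs_choice y with h | h <;> rw [h]
    simp
  · have := bernoulliFun_two |y|
    rw [bernoulliFun] at this
    have h2 : ((2 * 1).factorial : ℝ) = 2 := by norm_num [Nat.factorial]
    rw [h2, mul_one, this, sq_abs]
    ring

/-- Cosine coefficients of the `1`-periodic triangle function of height `1` and half-width `δ`. -/
def triangleCoeff (δ : ℝ) (n : ℕ) : ℝ :=
  if n = 0 then δ else (1 - Real.cos (2 * Real.pi * n * δ)) / (Real.pi ^ 2 * δ * n ^ 2)

theorem triangleCoeff_nonneg {δ : ℝ} (hδ : 0 < δ) (n : ℕ) : 0 ≤ triangleCoeff δ n := by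
  rw [triangleCoeff]
  split_ifs
  · exact hδ.le
  · have := Real.cos_le_one (2 * Real.pi * n * δ)
    have : 0 ≤ 1 - Real.cos (2 * Real.pi * n * δ) := by linarith
    positivity

theorem cos_two_pi_nat_mul_sub_int (n : ℕ) (x : ℝ) (k : ℤ) :
    Real.cos (2 * Real.pi * n * (x - k)) = Real.cos (2 * Real.pi * n * x) := by
  have : 2 * Real.pi * n * (x - k) = 2 * Real.pi * n * x - ((n * k : ℤ) : ℝ) * (2 * Real.pi) := by
    push_cast; ring
  rw [this, Real.cos_sub_int_mul_two_pi]

theorem hasSum_triangleCoeff {δ : ℝ} (hδ : 0 < δ) (hδ' : δ ≤ 1 / 2) (x : ℝ) :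
    HasSum (fun n : ℕ => triangleCoeff δ n * Real.cos (2 * Real.pi * n * x))
      (max 0 (1 - |x - round x| / δ)) := by
  set y : ℝ := x - round x with hy
  have hyb : |y| ≤ 1 / 2 := abs_sub_round x
  obtain ⟨hy1, hy2⟩ := abs_le.1 hyb
  have h0 := hasSum_cos_div_sq (y := y) (by linarith)
  have h1 := hasSum_cos_div_sq (y := y + δ) (abs_le.2 ⟨by linarith, by linarith⟩)
  have h2 := hasSum_cos_div_sq (y := y - δ) (abs_le.2 ⟨by linarith, by linarith⟩)
  have h3 := ((h0.sub ((h1.add h2).div_const 2)).div_const (Real.pi ^ 2 * δ)).add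
    (hasSum_ite_eq 0 δ)
  have hcoeff : ∀ n : ℕ, triangleCoeff δ n * Real.cos (2 * Real.pi * n * x) =
      (1 / (n : ℝ) ^ 2 * Real.cos (2 * Real.pi * n * y) -
        (1 / (n : ℝ) ^ 2 * Real.cos (2 * Real.pi * n * (y + δ)) +
          1 / (n : ℝ) ^ 2 * Real.cos (2 * Real.pi * n * (y - δ))) / 2) / (Real.pi ^ 2 * δ) +
      if n = 0 then δ else 0 := by
    intro n
    rw [← cos_two_pi_nat_mul_sub_int n x (round x), ← hy, triangleCoeff]
    split_ifs with hn
    · simp [hn]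
    · have hn' : (n : ℝ) ≠ 0 := by exact_mod_cast hn
      have e1 : 2 * Real.pi * n * (y + δ) = 2 * Real.pi * n * y + 2 * Real.pi * n * δ := by ring
      have e2 : 2 * Real.pi * n * (y - δ) = 2 * Real.pi * n * y - 2 * Real.pi * n * δ := by ring
      rw [e1, e2, Real.cos_add, Real.cos_sub]
      have := Real.pi_ne_zero
      field_simp
      ring
  have hval : max 0 (1 - |y| / δ) = (Real.pi ^ 2 * (y ^ 2 - |y| + 1 / 6) -
      (Real.pi ^ 2 * ((y + δ) ^ 2 - |y + δ| + 1 / 6) +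
        Real.pi ^ 2 * ((y - δ) ^ 2 - |y - δ| + 1 / 6)) / 2) / (Real.pi ^ 2 * δ) + δ := by
    have hpi := Real.pi_ne_zero
    have key : max 0 (1 - |y| / δ) = ((|y + δ| + |y - δ|) / 2 - |y|) / δ := by
      rcases le_total |y| δ with h | h
      · rw [max_eq_right (by rw [sub_nonneg, div_le_one hδ]; exact h)]
        obtain ⟨h4, h5⟩ := abs_le.1 h
        rw [abs_of_nonneg (by linarith : 0 ≤ y + δ), abs_of_nonpos (by linarith : y - δ ≤ 0)]
        field_simp
        ring
      · rw [max_eq_left (by rw [sub_nonpos, one_le_div hδ]; exact h)]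
        rcases le_total 0 y with h6 | h6
        · rw [abs_of_nonneg h6] at h ⊢
          rw [abs_of_nonneg (by linarith : 0 ≤ y + δ), abs_of_nonneg (by linarith : 0 ≤ y - δ)]
          ring
        · rw [abs_of_nonpos h6] at h ⊢
          rw [abs_of_nonpos (by linarith : y + δ ≤ 0), abs_of_nonpos (by linarith : y - δ ≤ 0)]
          ring
    rw [key]
    field_simp
    ring
  rw [funext hcoeff, hval]
  exact h3

theorem hasSum_triangleCoeff_one {δ : ℝ} (hδ : 0 < δ) (hδ' : δ ≤ 1 / 2) :
    HasSum (triangleCoeff δ) 1 := by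
  simpa using hasSum_triangleCoeff hδ hδ' 0

/-- A `1`-periodic trapezoid, `1` near the integers with small mean, has a cosine series with
coefficients of `ℓ¹` norm at most `3`, whatever its width. -/
theorem exists_trapezoid {δ : ℝ} (hδ : 0 < δ) (hδ' : δ ≤ 1 / 4) :
    ∃ a : ℕ → ℝ, a 0 = 3 * δ ∧ Summable (fun n => |a n|) ∧ ∑' n, |a n| ≤ 3 ∧
      (∀ x, 0 ≤ ∑' n : ℕ, a n * Real.cos (2 * Real.pi * n * x)) ∧
      (∀ x, ∑' n : ℕ, a n * Real.cos (2 * Real.pi * n * x) ≤ 1) ∧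
      ∀ x : ℝ, ∀ k : ℤ, |x - k| < δ → ∑' n : ℕ, a n * Real.cos (2 * Real.pi * n * x) = 1 := by
  have s1 := hasSum_triangleCoeff_one hδ (by linarith)
  have s2 := (hasSum_triangleCoeff_one (δ := 2 * δ) (by linarith) (by linarith)).mul_left 2
  have hle : ∀ n, |2 * triangleCoeff (2 * δ) n - triangleCoeff δ n|
      ≤ 2 * triangleCoeff (2 * δ) n + triangleCoeff δ n := by
    intro n
    have := triangleCoeff_nonneg hδ n
    have := triangleCoeff_nonneg (δ := 2 * δ) (by linarith) n
    rw [abs_le]; constructor <;> linarith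
  have hs : Summable (fun n => |2 * triangleCoeff (2 * δ) n - triangleCoeff δ n|) :=
    Summable.of_nonneg_of_le (fun _ => abs_nonneg _) hle (s2.add s1).summable
  have hval : ∀ x : ℝ, ∑' n : ℕ, (2 * triangleCoeff (2 * δ) n - triangleCoeff δ n) *
      Real.cos (2 * Real.pi * n * x) =
      2 * max 0 (1 - |x - round x| / (2 * δ)) - max 0 (1 - |x - round x| / δ) := by
    intro x
    have := ((hasSum_triangleCoeff (δ := 2 * δ) (by linarith) (by linarith) x).mul_left 2).sub
      (hasSum_triangleCoeff hδ (by linarith) x)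
    rw [← this.tsum_eq]
    congr 1; funext n; ring
  have hdiv : ∀ x : ℝ, |x - round x| / (2 * δ) = |x - round x| / δ / 2 := by
    intro x; field_simp
  refine ⟨fun n => 2 * triangleCoeff (2 * δ) n - triangleCoeff δ n, ?_, hs, ?_, ?_, ?_, ?_⟩
  · simp [triangleCoeff]; ring
  · refine (hs.tsum_le_tsum hle (s2.add s1).summable).trans ?_
    rw [(s2.add s1).tsum_eq]; norm_num
  · intro x
    rw [hval, hdiv]
    have : 0 ≤ |x - round x| / δ := by positivity
    rcases max_cases 0 (1 - |x - round x| / δ) with h | h <;>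
    rcases max_cases 0 (1 - |x - round x| / δ / 2) with h' | h' <;> linarith
  · intro x
    rw [hval, hdiv]
    have : 0 ≤ |x - round x| / δ := by positivity
    rcases max_cases 0 (1 - |x - round x| / δ) with h | h <;>
    rcases max_cases 0 (1 - |x - round x| / δ / 2) with h' | h' <;> linarith
  · intro x k hk
    rw [hval, hdiv]
    have h1 : |x - round x| / δ ≤ 1 := by
      rw [div_le_one hδ]
      exact (round_le x k).trans hk.le
    rw [max_eq_right (by linarith), max_eq_right (by linarith)]
    ring

theorem integrable_exp_mul {ν : Measure ℝ} {g : ℝ → ℂ} (hg : Integrable g ν) (ξ : ℝ) :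
    Integrable (fun x : ℝ =>
      Complex.exp (-(((2 * Real.pi * ξ * x : ℝ) : ℂ) * Complex.I)) * g x) ν := by
  refine hg.bdd_mul (c := 1) (Continuous.aestronglyMeasurable (by fun_prop)) (ae_of_all _ fun x => ?_)
  rw [← neg_mul, ← Complex.ofReal_neg, Complex.norm_exp_ofReal_mul_I]

theorem ae_eq_zero_of_cmFT_ofReal_eq_zero {ν : Measure ℝ} [IsFiniteMeasure ν] {f : ℝ → ℝ}
    (hf : Integrable f ν) (h : ∀ ξ, cmFT ν (fun x => (f x : ℂ)) ξ = 0) : f =ᵐ[ν] 0 := by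
  have hp := hf.pos_part
  have hn := hf.neg_part
  have hfn : Integrable (fun x => -f x) ν := hf.neg
  have key : ν.withDensity (fun x => ENNReal.ofReal (f x)) =
      ν.withDensity (fun x => ENNReal.ofReal (-f x)) := by
    have := isFiniteMeasure_withDensity_ofReal hf.2
    have := isFiniteMeasure_withDensity_ofReal hfn.2
    apply Measure.ext_of_charFun
    funext t
    rw [charFun_apply_real, charFun_apply_real,
      integral_withDensity_eq_integral_toReal_smul₀ hf.aemeasurable.ennreal_ofReal (by simp),
      integral_withDensity_eq_integral_toReal_smul₀ hfn.aemeasurable.ennreal_ofReal (by simp),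
      ← sub_eq_zero]
    have hexp : ∀ x : ℝ, Complex.exp (t * x * Complex.I) =
        Complex.exp (-(((2 * Real.pi * (-t / (2 * Real.pi)) * x : ℝ) : ℂ) * Complex.I)) := by
      intro x
      have : 2 * Real.pi * (-t / (2 * Real.pi)) * x = -(t * x) := by
        have := Real.pi_ne_zero
        field_simp
      rw [this]; push_cast; ring_nf
    simp_rw [hexp, Complex.real_smul, mul_comm (Complex.ofReal _) (Complex.exp _)]
    rw [← integral_sub]
    · rw [← h (-t / (2 * Real.pi)), cmFT]
      congr 1; funext x
      rw [← mul_sub, ← Complex.ofReal_sub]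
      congr 2
      rw [ENNReal.toReal_ofReal', ENNReal.toReal_ofReal']
      rcases le_total 0 (f x) with h0 | h0
      · rw [max_eq_left h0, max_eq_right (by linarith)]; ring
      · rw [max_eq_right h0, max_eq_left (by linarith)]; ring
    · refine integrable_exp_mul (g := fun x => (((ENNReal.ofReal (f x)).toReal : ℝ) : ℂ)) ?_ _
      exact (hp.congr (ae_of_all _ fun _ => ENNReal.toReal_ofReal'.symm)).ofReal
    · refine integrable_exp_mul (g := fun x => (((ENNReal.ofReal (-f x)).toReal : ℝ) : ℂ)) ?_ _
      exact (hn.congr (ae_of_all _ fun _ => ENNReal.toReal_ofReal'.symm)).ofReal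
  rw [withDensity_eq_iff_of_sigmaFinite hf.aemeasurable.ennreal_ofReal
    hfn.aemeasurable.ennreal_ofReal] at key
  filter_upwards [key] with x hx
  have := congrArg ENNReal.toReal hx
  simp only [ENNReal.toReal_ofReal'] at this
  rcases max_cases (f x) 0 with h | h <;> rcases max_cases (-f x) 0 with h' | h' <;>
    simp only [Pi.zero_apply] <;> linarith

theorem conj_cmFT (ν : Measure ℝ) (g : ℝ → ℂ) (ξ : ℝ) :
    starRingEnd ℂ (cmFT ν g ξ) = cmFT ν (fun x => starRingEnd ℂ (g x)) (-ξ) := by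
  rw [cmFT, cmFT, ← integral_conj]
  congr 1; funext x
  rw [map_mul, ← Complex.exp_conj, map_neg, map_mul, Complex.conj_ofReal, Complex.conj_I]
  push_cast
  ring_nf

/-- Uniqueness of the Fourier transform for finite complex measures `g dν`. -/
theorem ae_eq_zero_of_cmFT_eq_zero {ν : Measure ℝ} [IsFiniteMeasure ν] {g : ℝ → ℂ}
    (hg : Integrable g ν) (h : ∀ ξ, cmFT ν g ξ = 0) : g =ᵐ[ν] 0 := by
  have hc : ∀ ξ, cmFT ν (fun x => starRingEnd ℂ (g x)) ξ = 0 := by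
    intro ξ
    have := conj_cmFT ν g (-ξ)
    rw [h, map_zero, neg_neg] at this
    exact this.symm
  have hgc : Integrable (fun x => starRingEnd ℂ (g x)) ν :=
    (Complex.conjLIE.toContinuousLinearEquiv.toContinuousLinearMap).integrable_comp hg
  have hre : ∀ ξ, cmFT ν (fun x => ((g x).re : ℂ)) ξ = 0 := by
    intro ξ
    have : cmFT ν (fun x => ((g x).re : ℂ)) ξ =
        (cmFT ν g ξ + cmFT ν (fun x => starRingEnd ℂ (g x)) ξ) / 2 := by
      rw [cmFT, cmFT, cmFT, ← integral_add (integrable_exp_mul hg ξ) (integrable_exp_mul hgc ξ),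
        ← integral_div]
      congr 1; funext x
      rw [Complex.re_eq_add_conj]; ring
    rw [this, h, hc]; simp
  have him : ∀ ξ, cmFT ν (fun x => ((g x).im : ℂ)) ξ = 0 := by
    intro ξ
    have : cmFT ν (fun x => ((g x).im : ℂ)) ξ =
        (cmFT ν g ξ - cmFT ν (fun x => starRingEnd ℂ (g x)) ξ) / (2 * Complex.I) := by
      rw [cmFT, cmFT, cmFT, ← integral_sub (integrable_exp_mul hg ξ) (integrable_exp_mul hgc ξ),
        ← integral_div]
      congr 1; funext x
      rw [Complex.im_eq_sub_conj]; ring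
    rw [this, h, hc]; simp
  filter_upwards [ae_eq_zero_of_cmFT_ofReal_eq_zero hg.re hre,
    ae_eq_zero_of_cmFT_ofReal_eq_zero hg.im him] with x h1 h2
  exact Complex.ext h1 h2

theorem norm_cmFT_le (ν : Measure ℝ) (g : ℝ → ℂ) (ξ : ℝ) :
    ‖cmFT ν g ξ‖ ≤ ∫ x, ‖g x‖ ∂ν := by
  refine (norm_integral_le_integral_norm _).trans (le_of_eq ?_)
  congr 1; funext x
  rw [norm_mul, ← neg_mul, ← Complex.ofReal_neg, Complex.norm_exp_ofReal_mul_I, one_mul]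

/-- If an analytic trigonometric polynomial with constant term `1`, dilated by `N`, is at most `ε`
where `g dν` lives, then `ν̂(ξ)` is controlled by `ν̂(ξ + kN)`, `k ≥ 1`. -/
theorem norm_cmFT_le_of_poly {ν : Measure ℝ} {g : ℝ → ℂ} (hg : Integrable g ν) {K : ℕ}
    {c : ℕ → ℂ} (hc : c 0 = 1) {N ε B ξ : ℝ}
    (hsmall : ∀ᵐ x ∂ν, g x ≠ 0 → ‖∑ k ∈ Finset.range (K + 1), c k *
      Complex.exp (-(((2 * Real.pi * (N * x) : ℝ) : ℂ) * Complex.I)) ^ k‖ ≤ ε)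
    (hB : ∀ k : ℕ, 1 ≤ k → ‖cmFT ν g (ξ + k * N)‖ ≤ B) :
    ‖cmFT ν g ξ‖ ≤ ε * ∫ x, ‖g x‖ ∂ν + (∑ k ∈ Finset.range (K + 1), ‖c k‖) * B := by
  have hB0 : 0 ≤ B := (norm_nonneg _).trans (hB 1 le_rfl)
  have hsum : ∑ k ∈ Finset.range (K + 1), c k * cmFT ν g (ξ + k * N) =
      ∫ x, Complex.exp (-(((2 * Real.pi * ξ * x : ℝ) : ℂ) * Complex.I)) *
        (∑ k ∈ Finset.range (K + 1), c k *
          Complex.exp (-(((2 * Real.pi * (N * x) : ℝ) : ℂ) * Complex.I)) ^ k) * g x ∂ν := by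
    simp_rw [cmFT, ← integral_const_mul]
    rw [← integral_finsetSum _ fun k _ => (integrable_exp_mul hg _).const_mul _]
    congr 1; funext x
    rw [Finset.mul_sum, Finset.sum_mul]
    refine Finset.sum_congr rfl fun k _ => ?_
    rw [← Complex.exp_nat_mul]
    have : Complex.exp (-(((2 * Real.pi * (ξ + k * N) * x : ℝ) : ℂ) * Complex.I)) =
        Complex.exp (-(((2 * Real.pi * ξ * x : ℝ) : ℂ) * Complex.I)) *
        Complex.exp (k * -(((2 * Real.pi * (N * x) : ℝ) : ℂ) * Complex.I)) := by
      rw [← Complex.exp_add]; congr 1; push_cast; ring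
    rw [this]; ring
  have h1 : ‖∑ k ∈ Finset.range (K + 1), c k * cmFT ν g (ξ + k * N)‖ ≤ ε * ∫ x, ‖g x‖ ∂ν := by
    rw [hsum, ← integral_const_mul]
    refine norm_integral_le_of_norm_le (hg.norm.const_mul _) ?_
    filter_upwards [hsmall] with x hx
    rw [norm_mul, norm_mul, ← neg_mul, ← Complex.ofReal_neg, Complex.norm_exp_ofReal_mul_I,
      one_mul]
    by_cases h0 : g x = 0
    · simp [h0]
    · gcongr
      exact hx h0
  rw [Finset.sum_range_succ'] at h1 ⊢
  rw [hc] at h1 ⊢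
  simp only [Nat.cast_zero, zero_mul, add_zero, one_mul] at h1
  have h2 : ‖∑ k ∈ Finset.range K, c (k + 1) * cmFT ν g (ξ + (k + 1 : ℕ) * N)‖ ≤
      (∑ k ∈ Finset.range K, ‖c (k + 1)‖) * B := by
    rw [Finset.sum_mul]
    refine (norm_sum_le _ _).trans (Finset.sum_le_sum fun k _ => ?_)
    rw [norm_mul]
    gcongr
    exact hB _ (by omega)
  have h3 := norm_sub_norm_le (cmFT ν g ξ)
    (-∑ k ∈ Finset.range K, c (k + 1) * cmFT ν g (ξ + (k + 1 : ℕ) * N))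
  rw [norm_neg, sub_neg_eq_add, add_comm (cmFT ν g ξ)] at h3
  have : 0 ≤ ‖(1 : ℂ)‖ * B := by positivity
  linarith [add_mul (∑ k ∈ Finset.range K, ‖c (k + 1)‖) ‖(1 : ℂ)‖ B]

theorem continuous_cmFT {ν : Measure ℝ} {g : ℝ → ℂ} (hg : Integrable g ν) :
    Continuous (cmFT ν g) := by
  unfold cmFT
  refine continuous_of_dominated (bound := fun x => ‖g x‖)
    (fun ξ => (integrable_exp_mul hg ξ).aestronglyMeasurable)
    (fun ξ => ae_of_all _ fun x => ?_) hg.norm (ae_of_all _ fun x => by fun_prop)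
  rw [norm_mul, ← neg_mul, ← Complex.ofReal_neg, Complex.norm_exp_ofReal_mul_I, one_mul]

theorem cmFT_volume_eq_fourier (u : ℝ → ℂ) : cmFT volume u = FourierTransform.fourier u := by
  funext ξ
  rw [Real.fourier_real_eq_integral_exp_smul, cmFT]
  congr 1; funext x
  rw [smul_eq_mul]
  congr 2
  push_cast; ring

theorem lintegral_enorm_cmFT_sq_le {u : ℝ → ℂ} (hc : Continuous u) (hu : Integrable u)
    (hb : ∀ x, ‖u x‖ ≤ 1) (hF : Integrable (cmFT volume u)) :
    ∫⁻ ξ, ‖cmFT volume u ξ‖ₑ ^ 2 ≤ ∫⁻ x, ‖u x‖ₑ := by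
  have hF' : Integrable (FourierTransform.fourier u) := by rwa [← cmFT_volume_eq_fourier]
  have h1 : ∫ ξ, inner ℂ (FourierTransform.fourier u ξ) (FourierTransform.fourier u ξ) =
      ∫ x, inner ℂ (u x) (u x) := by
    have h2 : ∫ ξ, innerSL ℂ (FourierTransform.fourier u ξ) (FourierTransform.fourier u ξ) =
        ∫ x, innerSL ℂ (u x)
          (FourierTransformInv.fourierInv (FourierTransform.fourier u) x) := by
      have h := VectorFourier.integral_sesq_fourierIntegral_eq_neg_flip (innerSL ℂ)
        (L := innerₗ ℝ) Real.continuous_fourierChar continuous_inner hu hF'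
      rw [flip_innerₗ] at h
      exact h
    rw [hc.fourierInv_fourier_eq hu hF'] at h2
    exact h2
  have h3 : ∫ ξ, ‖cmFT volume u ξ‖ ^ 2 = ∫ x, ‖u x‖ ^ 2 := by
    apply Complex.ofRealLI.injective
    rw [cmFT_volume_eq_fourier]
    simpa [← LinearIsometry.integral_comp_comm, inner_self_eq_norm_sq_to_K] using h1
  have hφint : Integrable (fun ξ => ‖cmFT volume u ξ‖ ^ 2) := by
    simp_rw [pow_two]
    exact hF.norm.bdd_mul (c := ∫ x, ‖u x‖) (continuous_cmFT hu).norm.aestronglyMeasurable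
      (ae_of_all _ fun ξ => by rw [norm_norm]; exact norm_cmFT_le _ _ _)
  have husq : Integrable (fun x => ‖u x‖ ^ 2) := by
    simp_rw [pow_two]
    exact hu.norm.bdd_mul (c := 1) hc.norm.aestronglyMeasurable
      (ae_of_all _ fun x => by rw [norm_norm]; exact hb x)
  calc ∫⁻ ξ, ‖cmFT volume u ξ‖ₑ ^ 2 = ∫⁻ ξ, ENNReal.ofReal (‖cmFT volume u ξ‖ ^ 2) := by
        congr 1; funext ξ
        rw [ENNReal.ofReal_pow (norm_nonneg _), ofReal_norm]
    _ = ENNReal.ofReal (∫ x, ‖u x‖ ^ 2) := by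
        rw [← ofReal_integral_eq_lintegral_ofReal hφint (ae_of_all _ fun _ => by positivity), h3]
    _ = ∫⁻ x, ‖u x‖ₑ ^ 2 := by
        rw [ofReal_integral_eq_lintegral_ofReal husq (ae_of_all _ fun _ => by positivity)]
        congr 1; funext x
        rw [ENNReal.ofReal_pow (norm_nonneg _), ofReal_norm]
    _ ≤ ∫⁻ x, ‖u x‖ₑ := by
        refine lintegral_mono fun x => ?_
        have : ‖u x‖ₑ ≤ 1 := by
          rw [← ofReal_norm]; exact ENNReal.ofReal_le_one.2 (hb x)
        rw [pow_two]
        calc ‖u x‖ₑ * ‖u x‖ₑ ≤ ‖u x‖ₑ * 1 := by gcongr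
          _ = _ := mul_one _

theorem cmFT_mul_cos {u : ℝ → ℂ} (hu : Integrable u) (t ξ : ℝ) :
    cmFT volume (fun x => u x * ((Real.cos (2 * Real.pi * t * x) : ℝ) : ℂ)) ξ =
      (cmFT volume u (ξ - t) + cmFT volume u (ξ + t)) / 2 := by
  rw [cmFT, cmFT, cmFT, ← integral_add (integrable_exp_mul hu _) (integrable_exp_mul hu _),
    ← integral_div]
  congr 1; funext x
  have e1 : Complex.exp (-(((2 * Real.pi * (ξ - t) * x : ℝ) : ℂ) * Complex.I)) =
      Complex.exp (-(((2 * Real.pi * ξ * x : ℝ) : ℂ) * Complex.I)) *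
      Complex.exp (((2 * Real.pi * t * x : ℝ) : ℂ) * Complex.I) := by
    rw [← Complex.exp_add]; congr 1; push_cast; ring
  have e2 : Complex.exp (-(((2 * Real.pi * (ξ + t) * x : ℝ) : ℂ) * Complex.I)) =
      Complex.exp (-(((2 * Real.pi * ξ * x : ℝ) : ℂ) * Complex.I)) *
      Complex.exp (-((2 * Real.pi * t * x : ℝ) : ℂ) * Complex.I) := by
    rw [← Complex.exp_add]; congr 1; push_cast; ring
  rw [e1, e2, Complex.ofReal_cos, Complex.cos]
  ring

theorem summable_mul_cos {a : ℕ → ℝ} (ha : Summable (fun n => |a n|)) (y : ℝ) :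
    Summable (fun n : ℕ => a n * Real.cos (2 * Real.pi * n * y)) := by
  refine Summable.of_norm_bounded ha fun n => ?_
  rw [norm_mul, Real.norm_eq_abs, Real.norm_eq_abs]
  exact mul_le_of_le_one_right (abs_nonneg _) (Real.abs_cos_le_one _)

theorem continuous_cosSeries {a : ℕ → ℝ} (ha : Summable (fun n => |a n|)) :
    Continuous (fun y : ℝ => ∑' n : ℕ, a n * Real.cos (2 * Real.pi * n * y)) := by
  refine continuous_tsum (fun n => by fun_prop) ha fun n y => ?_
  rw [norm_mul, Real.norm_eq_abs, Real.norm_eq_abs]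
  exact mul_le_of_le_one_right (abs_nonneg _) (Real.abs_cos_le_one _)

theorem lintegral_tsum_translates {F : ℝ → ENNReal} (hF : Measurable F) (b : ℕ → ENNReal)
    (t : ℕ → ℝ) :
    ∫⁻ ξ, ∑' n, b n * ((F (ξ - t n) + F (ξ + t n)) / 2) = (∑' n, b n) * ∫⁻ ξ, F ξ := by
  have h1 : ∀ n, Measurable (fun ξ => F (ξ - t n)) := fun n => hF.comp (by fun_prop)
  have h2 : ∀ n, Measurable (fun ξ => F (ξ + t n)) := fun n => hF.comp (by fun_prop)
  have h3 : ∀ n, Measurable (fun ξ => F (ξ - t n) + F (ξ + t n)) := fun n => (h1 n).add (h2 n)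
  simp_rw [ENNReal.div_eq_inv_mul]
  rw [lintegral_tsum fun n => (((h3 n).const_mul _).const_mul _).aemeasurable,
    ← ENNReal.tsum_mul_right]
  congr 1; funext n
  rw [lintegral_const_mul _ ((h3 n).const_mul _),
    lintegral_const_mul _ (h3 n), lintegral_add_left (h1 n),
    lintegral_sub_right_eq_self F, lintegral_add_right_eq_self F, ← two_mul, ← mul_assoc 2⁻¹,
    ENNReal.inv_mul_cancel (by norm_num) (by norm_num), one_mul]

/-- Multiplication by a dilated absolutely convergent cosine series acts boundedly on functions with
integrable Fourier transform. -/
theorem lintegral_enorm_cmFT_mul_cosSeries_le {u : ℝ → ℂ} (hu : Integrable u) {a : ℕ → ℝ}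
    (ha : Summable (fun n => |a n|)) (N : ℝ) :
    ∫⁻ ξ, ‖cmFT volume (fun x => u x *
        ((∑' n : ℕ, a n * Real.cos (2 * Real.pi * n * (N * x)) : ℝ) : ℂ)) ξ‖ₑ ≤
      ENNReal.ofReal (∑' n, |a n|) * ∫⁻ ξ, ‖cmFT volume u ξ‖ₑ := by
  have hmeas : Measurable (fun ξ => ‖cmFT volume u ξ‖ₑ) :=
    (continuous_cmFT hu).enorm.measurable
  have hterm : ∀ ξ, cmFT volume (fun x => u x *
        ((∑' n : ℕ, a n * Real.cos (2 * Real.pi * n * (N * x)) : ℝ) : ℂ)) ξ =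
      ∑' n : ℕ, (a n : ℂ) * ((cmFT volume u (ξ - n * N) + cmFT volume u (ξ + n * N)) / 2) := by
    intro ξ
    simp_rw [← cmFT_mul_cos hu, cmFT, ← integral_const_mul]
    rw [integral_tsum_of_summable_integral_norm]
    · congr 1; funext x
      rw [Complex.ofReal_tsum, ← tsum_mul_left, ← tsum_mul_left]
      congr 1; funext n
      push_cast
      ring_nf
    · intro n
      refine Integrable.const_mul (integrable_exp_mul ?_ _) _
      refine hu.mul_bdd (c := 1) (Continuous.aestronglyMeasurable (by fun_prop))
        (ae_of_all _ fun x => ?_)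
      rw [Complex.norm_real]
      exact Real.abs_cos_le_one _
    · refine Summable.of_nonneg_of_le (fun n => integral_nonneg fun x => norm_nonneg _)
        (fun n => ?_) (ha.mul_right (∫ x, ‖u x‖))
      rw [← integral_const_mul]
      refine integral_mono_of_nonneg (ae_of_all _ fun x => norm_nonneg _)
        (hu.norm.const_mul _) (ae_of_all _ fun x => ?_)
      simp only
      rw [norm_mul, norm_mul, norm_mul, ← neg_mul, ← Complex.ofReal_neg,
        Complex.norm_exp_ofReal_mul_I, Complex.norm_real, Complex.norm_real, one_mul,
        Real.norm_eq_abs, Real.norm_eq_abs]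
      exact mul_le_mul_of_nonneg_left
        (mul_le_of_le_one_right (norm_nonneg _) (Real.abs_cos_le_one _)) (abs_nonneg _)
  calc _ ≤ ∫⁻ ξ, ∑' n : ℕ, ENNReal.ofReal |a n| *
        ((‖cmFT volume u (ξ - n * N)‖ₑ + ‖cmFT volume u (ξ + n * N)‖ₑ) / 2) := by
        refine lintegral_mono fun ξ => ?_
        rw [hterm]
        refine enorm_tsum_le_tsum_enorm.trans (ENNReal.tsum_le_tsum fun n => ?_)
        rw [enorm_mul, ← ofReal_norm (a n : ℂ), Complex.norm_real, Real.norm_eq_abs,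
          div_eq_mul_inv, enorm_mul, ENNReal.div_eq_inv_mul, mul_comm _ ‖(2 : ℂ)⁻¹‖ₑ]
        have : ‖(2 : ℂ)⁻¹‖ₑ = 2⁻¹ := by
          rw [enorm_inv (by norm_num), ← ofReal_norm]; simp
        rw [this]
        gcongr
        exact enorm_add_le _ _
    _ = _ := by
        rw [lintegral_tsum_translates hmeas, ENNReal.ofReal_tsum_of_nonneg (fun _ => abs_nonneg _) ha]

theorem lintegral_enorm_cmFT_rpow_le {u : ℝ → ℂ} (hc : Continuous u) (hu : Integrable u)
    (hb : ∀ x, ‖u x‖ ≤ 1) {A B : ENNReal} (hA : A ≠ ⊤) (hF : ∫⁻ ξ, ‖cmFT volume u ξ‖ₑ ≤ A)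
    (hB : ∫⁻ x, ‖u x‖ₑ ≤ B) {r : ℝ} (hr1 : 1 < r) (hr2 : r < 2) :
    ∫⁻ ξ, ‖cmFT volume u ξ‖ₑ ^ r ≤ A ^ (2 - r) * B ^ (r - 1) := by
  have hm := (continuous_cmFT hu).enorm.measurable
  have hi : Integrable (cmFT volume u) :=
    ⟨(continuous_cmFT hu).aestronglyMeasurable, hF.trans_lt hA.lt_top⟩
  calc ∫⁻ ξ, ‖cmFT volume u ξ‖ₑ ^ r
      = ∫⁻ ξ, ‖cmFT volume u ξ‖ₑ ^ (2 - r) * (‖cmFT volume u ξ‖ₑ ^ 2) ^ (r - 1) := by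
        congr 1; funext ξ
        rw [← ENNReal.rpow_natCast, ← ENNReal.rpow_mul,
          ← ENNReal.rpow_add_of_nonneg _ _ (by linarith) (by push_cast; linarith)]
        congr 1; push_cast; ring
    _ ≤ (∫⁻ ξ, ‖cmFT volume u ξ‖ₑ) ^ (2 - r) * (∫⁻ ξ, ‖cmFT volume u ξ‖ₑ ^ 2) ^ (r - 1) :=
        ENNReal.lintegral_mul_norm_pow_le hm.aemeasurable (hm.pow_const 2).aemeasurable
          (by linarith) (by linarith) (by ring)
    _ ≤ A ^ (2 - r) * B ^ (r - 1) := by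
        have h1 : 0 ≤ r - 1 := by linarith
        have h2 : 0 ≤ 2 - r := by linarith
        gcongr
        exact (lintegral_enorm_cmFT_sq_le hc hu hb hi).trans hB

theorem summable_mul_pow_pow {B p : ℝ} (hB : 0 ≤ B) (hp0 : 0 ≤ p) (hp1 : p < 1) :
    Summable (fun n : ℕ => (B * p ^ n) ^ n) := by
  have h := ((tendsto_pow_atTop_nhds_zero_of_lt_one hp0 hp1).const_mul B)
  rw [mul_zero] at h
  refine Summable.of_norm_bounded_eventually_nat
    (summable_geometric_of_lt_one (r := 1 / 2) (by norm_num) (by norm_num)) ?_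
  filter_upwards [h.eventually_le_const (by norm_num : (0 : ℝ) < 1 / 2)] with n hn
  rw [Real.norm_of_nonneg (by positivity)]
  exact pow_le_pow_left₀ (by positivity) hn n

theorem summable_interpolated {A r : ℝ} (hA : 0 ≤ A) (hr1 : 1 < r) :
    Summable (fun n : ℕ => ((3 * (4 ^ n * A)) ^ (2 - r) *
      (12 * (1 / 4) ^ (n + 3) ^ 2) ^ (r - 1)) ^ (1 / r) : ℕ → ℝ) := by
  have hp : (((1 : ℝ) / 4) ^ (r - 1)) ^ (1 / r) < 1 :=
    Real.rpow_lt_one (by positivity)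
      (Real.rpow_lt_one (by norm_num) (by norm_num) (by linarith)) (by positivity)
  refine Summable.of_nonneg_of_le (fun n => by positivity) (fun n => ?_)
    ((summable_mul_pow_pow (B := ((4 : ℝ) ^ (2 - r)) ^ (1 / r)) (by positivity)
      (by positivity) hp).mul_left (((3 * A) ^ (2 - r) * 12 ^ (r - 1)) ^ (1 / r)))
  calc ((3 * (4 ^ n * A)) ^ (2 - r) * (12 * (1 / 4) ^ (n + 3) ^ 2) ^ (r - 1)) ^ (1 / r)
      ≤ ((3 * (4 ^ n * A)) ^ (2 - r) * (12 * ((1 / 4) ^ n) ^ n) ^ (r - 1)) ^ (1 / r) := by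
        have : ((1 : ℝ) / 4) ^ (n + 3) ^ 2 ≤ ((1 / 4) ^ n) ^ n := by
          rw [← pow_mul]
          exact pow_le_pow_of_le_one (by norm_num) (by norm_num) (by nlinarith)
        have h1 : 0 ≤ r - 1 := by linarith
        gcongr
    _ = _ := by
        have e1 : (3 * ((4 : ℝ) ^ n * A)) ^ (2 - r) = (3 * A) ^ (2 - r) * (4 ^ (2 - r)) ^ n := by
          rw [Real.rpow_pow_comm (by positivity), ← Real.mul_rpow (by positivity) (by positivity)]
          ring_nf
        have e2 : (12 * (((1 : ℝ) / 4) ^ n) ^ n) ^ (r - 1) =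
            12 ^ (r - 1) * (((1 / 4) ^ (r - 1)) ^ n) ^ n := by
          rw [Real.rpow_pow_comm (by positivity), Real.rpow_pow_comm (by positivity),
            ← Real.mul_rpow (by positivity) (by positivity)]
        have e3 : (((4 : ℝ) ^ (2 - r)) ^ (1 / r) * (((1 / 4) ^ (r - 1)) ^ (1 / r)) ^ n) ^ n =
            ((4 ^ (2 - r)) ^ n * (((1 / 4) ^ (r - 1)) ^ n) ^ n) ^ (1 / r) := by
          have key : ∀ a b s : ℝ, 0 ≤ a → 0 ≤ b →
              (a ^ s * (b ^ s) ^ n) ^ n = (a ^ n * (b ^ n) ^ n) ^ s := by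
            intro a b s ha hb
            rw [Real.rpow_pow_comm hb, ← Real.mul_rpow ha (by positivity),
              Real.rpow_pow_comm (by positivity), mul_pow]
          exact key _ _ _ (by positivity) (by positivity)
        rw [e1, e2, e3, ← Real.mul_rpow (by positivity) (by positivity)]
        congr 1
        ring

theorem exists_bump : ∃ f : ℝ → ℝ, Continuous f ∧ (∀ x, 0 ≤ f x) ∧ (∀ x, f x ≤ 1) ∧
    (∀ x, x ∉ Icc (-2 : ℝ) 2 → f x = 0) ∧ 2 ≤ ∫ x, f x ∧
    ∫⁻ ξ, ‖cmFT volume (fun x => (f x : ℂ)) ξ‖ₑ ≠ ⊤ := by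
  let b : ContDiffBump (0 : ℝ) := ⟨1, 2, by norm_num, by norm_num⟩
  have hsupp : ∀ x, x ∉ Icc (-2 : ℝ) 2 → b x = 0 := by
    intro x hx
    apply b.zero_of_le_dist
    rw [Real.dist_0_eq_abs]
    by_contra! h
    exact hx (abs_le.1 h.le)
  refine ⟨b, b.continuous, fun x => b.nonneg, fun x => b.le_one, hsupp, ?_, ?_⟩
  · have hi : Integrable (b : ℝ → ℝ) := b.continuous.integrable_of_hasCompactSupport
      b.hasCompactSupport
    calc (2 : ℝ) = ∫ x, (Icc (-1 : ℝ) 1).indicator (fun _ => (1 : ℝ)) x := by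
          rw [integral_indicator measurableSet_Icc]; norm_num
      _ ≤ ∫ x, b x := by
          refine integral_mono ((integrable_indicator_iff measurableSet_Icc).2 (by simp)) hi ?_
          intro x
          by_cases hx : x ∈ Icc (-1 : ℝ) 1
          · have : b x = 1 := b.one_of_mem_closedBall (by
              rw [Metric.mem_closedBall, Real.dist_0_eq_abs]; exact abs_le.2 hx)
            simp [hx, this]
          · simp [hx, b.nonneg]
  · have hcs : HasCompactSupport (fun x => ((b x : ℝ) : ℂ)) :=
      b.hasCompactSupport.comp_left (g := fun y : ℝ => (y : ℂ)) Complex.ofReal_zero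
    have hcd : ContDiff ℝ ((⊤ : ℕ∞) : WithTop ℕ∞) (fun x => ((b x : ℝ) : ℂ)) :=
      Complex.ofRealCLM.contDiff.comp b.contDiff
    have hi := (FourierTransform.fourier (hcs.toSchwartzMap hcd)).integrable (μ := volume)
    rw [cmFT_volume_eq_fourier]
    have h2 := hi.2
    rw [SchwartzMap.fourier_coe] at h2
    exact h2.ne

theorem integral_cosSeries {a : ℕ → ℝ} (ha : Summable (fun n => |a n|)) {N : ℕ} (hN : N ≠ 0) :
    ∫ x in (-2 : ℝ)..2, ∑' n : ℕ, a n * Real.cos (2 * Real.pi * n * (N * x)) = 4 * a 0 := by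
  have h := intervalIntegral.hasSum_integral_of_dominated_convergence (a := -2) (b := 2)
    (μ := volume) (F := fun (n : ℕ) (x : ℝ) => a n * Real.cos (2 * Real.pi * n * (N * x)))
    (f := fun x => ∑' n : ℕ, a n * Real.cos (2 * Real.pi * n * (N * x)))
    (fun n _ => |a n|)
    (fun n => Continuous.aestronglyMeasurable (by fun_prop))
    (fun n => ae_of_all _ fun x _ => by
      rw [norm_mul, Real.norm_eq_abs, Real.norm_eq_abs]
      exact mul_le_of_le_one_right (abs_nonneg _) (Real.abs_cos_le_one _))
    (ae_of_all _ fun x _ => ha) (by simp)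
    (ae_of_all _ fun x _ => (summable_mul_cos ha (N * x)).hasSum)
  rw [← h.tsum_eq, tsum_eq_single 0]
  · norm_num
  · intro n hn
    have hn' : (n : ℝ) ≠ 0 := by exact_mod_cast hn
    have hN' : (N : ℝ) ≠ 0 := by exact_mod_cast hN
    have hc : 2 * Real.pi * n * N ≠ 0 := by have := Real.pi_ne_zero; positivity
    have : ∀ x : ℝ, 2 * Real.pi * n * (N * x) = (2 * Real.pi * n * N) * x := by intro x; ring
    simp_rw [this]
    rw [intervalIntegral.integral_const_mul,
      intervalIntegral.integral_comp_mul_left (fun y => Real.cos y) hc, integral_cos]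
    have e1 : 2 * Real.pi * n * N * 2 = ((4 * n * N : ℕ) : ℝ) * Real.pi := by push_cast; ring
    have e2 : 2 * Real.pi * n * N * (-2) = -(((4 * n * N : ℕ) : ℝ) * Real.pi) := by
      push_cast; ring
    rw [e1, e2, Real.sin_neg, Real.sin_nat_mul_pi]
    simp

theorem eLpNorm_lt_top_of_tendsto_of_tsum {p : ENNReal} (hp : 1 ≤ p) {w d : ℕ → ℝ → ℂ}
    {W : ℝ → ℂ} (hw : ∀ n, AEStronglyMeasurable (w n)) (hd : ∀ n, AEStronglyMeasurable (d n))
    (hrec : ∀ n, w (n + 1) = w n - d n) (h0 : eLpNorm (w 0) p volume ≠ ⊤)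
    (hsum : ∑' n, eLpNorm (d n) p volume ≠ ⊤)
    (hlim : ∀ ξ, Tendsto (fun n => w n ξ) atTop (𝓝 (W ξ))) :
    eLpNorm W p volume < ⊤ := by
  have hbound : ∀ n, eLpNorm (w n) p volume ≤
      eLpNorm (w 0) p volume + ∑ i ∈ Finset.range n, eLpNorm (d i) p volume := by
    intro n
    induction n with
    | zero => simp
    | succ n ih =>
      rw [hrec, Finset.sum_range_succ, ← add_assoc]
      exact (eLpNorm_sub_le (hw n) (hd n) hp).trans (by gcongr)
  refine (Lp.eLpNorm_lim_le_liminf_eLpNorm hw W (ae_of_all _ hlim)).trans_lt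
    (lt_of_le_of_lt ?_ (ENNReal.add_lt_top.2 ⟨h0.lt_top, hsum.lt_top⟩))
  refine (liminf_le_liminf (Eventually.of_forall fun n => (hbound n).trans
    (add_le_add le_rfl (ENNReal.sum_le_tsum _)))).trans ?_
  simp

theorem cmFT_sub {ν : Measure ℝ} {g h : ℝ → ℂ} (hg : Integrable g ν) (hh : Integrable h ν) :
    cmFT ν (fun x => g x - h x) = cmFT ν g - cmFT ν h := by
  funext ξ
  simp only [cmFT, Pi.sub_apply, mul_sub]
  exact integral_sub (integrable_exp_mul hg ξ) (integrable_exp_mul hh ξ)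

theorem tendsto_cmFT_of_dominated {ν : Measure ℝ} {g : ℕ → ℝ → ℂ} {G : ℝ → ℂ} {b : ℝ → ℝ}
    (hg : ∀ n, Integrable (g n) ν) (hb : Integrable b ν) (hgb : ∀ n x, ‖g n x‖ ≤ b x)
    (hlim : ∀ x, Tendsto (fun n => g n x) atTop (𝓝 (G x))) (ξ : ℝ) :
    Tendsto (fun n => cmFT ν (g n) ξ) atTop (𝓝 (cmFT ν G ξ)) := by
  refine tendsto_integral_of_dominated_convergence b
    (fun n => (integrable_exp_mul (hg n) ξ).aestronglyMeasurable) hb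
    (fun n => ae_of_all _ fun x => ?_) (ae_of_all _ fun x => (hlim x).const_mul _)
  rw [norm_mul, ← neg_mul, ← Complex.ofReal_neg, Complex.norm_exp_ofReal_mul_I, one_mul]
  exact hgb n x

theorem exists_infinite_product_density {φ : ℕ → ℝ → ℝ} (hc : ∀ n, Continuous (φ n))
    (h0 : ∀ n x, 0 ≤ φ n x) (h1 : ∀ n x, φ n x ≤ 1)
    (hφint : ∀ n, ∫ x in (-2 : ℝ)..2, φ n x ≤ 12 * (1 / 4) ^ (n + 3) ^ 2)
    (hF : ∀ n (u : ℝ → ℂ), Integrable u →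
      ∫⁻ ξ, ‖cmFT volume (fun x => u x * (φ n x : ℂ)) ξ‖ₑ ≤ 3 * ∫⁻ ξ, ‖cmFT volume u ξ‖ₑ) :
    ∃ f : ℝ → ℝ, Measurable f ∧ (∀ x, 0 ≤ f x) ∧ (∀ x, f x ≤ 1) ∧
      (∀ x, x ∉ Icc (-2 : ℝ) 2 → f x = 0) ∧ (∀ n x, φ n x = 1 → f x = 0) ∧ 0 < ∫ x, f x ∧
      ∀ r : ℝ, 1 < r → r < 2 → ∫⁻ ξ, ‖cmFT volume (fun x => (f x : ℂ)) ξ‖ₑ ^ r < ⊤ := by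
  obtain ⟨b, bc, b0, b1, bs, bint, bF⟩ := exists_bump
  set F : ℕ → ℝ → ℝ := fun n x => b x * ∏ i ∈ Finset.range n, (1 - φ i x) with hFdef
  have hFc : ∀ n, Continuous (F n) := fun n =>
    bc.mul (continuous_finsetProd _ fun i _ => continuous_const.sub (hc i))
  have hF0 : ∀ n x, 0 ≤ F n x := fun n x =>
    mul_nonneg (b0 x) (Finset.prod_nonneg fun i _ => sub_nonneg.2 (h1 i x))
  have hFb : ∀ n x, F n x ≤ b x := fun n x => mul_le_of_le_one_right (b0 x)
    (Finset.prod_le_one (fun i _ => sub_nonneg.2 (h1 i x)) fun i _ => by linarith [h0 i x])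
  have hFs : ∀ n x, F (n + 1) x = F n x - F n x * φ n x := by
    intro n x; simp only [hFdef, Finset.prod_range_succ]; ring
  have hbi : Integrable b := bc.integrable_of_hasCompactSupport
    (HasCompactSupport.intro isCompact_Icc bs)
  have hi : ∀ {g : ℝ → ℝ}, Continuous g → (∀ x, 0 ≤ g x) → (∀ x, g x ≤ b x) → Integrable g :=
    fun hg hg0 hgb => hbi.mono' hg.aestronglyMeasurable
      (ae_of_all _ fun x => by rw [Real.norm_of_nonneg (hg0 x)]; exact hgb x)
  have hFi : ∀ n, Integrable (F n) := fun n => hi (hFc n) (hF0 n) (hFb n)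
  have hdc : ∀ n, Continuous fun x => F n x * φ n x := fun n => (hFc n).mul (hc n)
  have hd0 : ∀ n x, 0 ≤ F n x * φ n x := fun n x => mul_nonneg (hF0 n x) (h0 n x)
  have hdF : ∀ n x, F n x * φ n x ≤ F n x := fun n x => mul_le_of_le_one_right (hF0 n x) (h1 n x)
  have hdb : ∀ n x, F n x * φ n x ≤ b x := fun n x => (hdF n x).trans (hFb n x)
  have hdi : ∀ n, Integrable fun x => F n x * φ n x := fun n => hi (hdc n) (hd0 n) (hdb n)
  have hd_le : ∀ n x, F n x * φ n x ≤ (Icc (-2 : ℝ) 2).indicator (φ n) x := by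
    intro n x
    by_cases hx : x ∈ Icc (-2 : ℝ) 2
    · rw [indicator_of_mem hx]
      exact mul_le_of_le_one_left (h0 n x) ((hFb n x).trans (b1 x))
    · rw [indicator_of_notMem hx]
      exact (hdb n x).trans (bs x hx).le
  have hd_int : ∀ n, ∫ x, F n x * φ n x ≤ 12 * (1 / 4) ^ (n + 3) ^ 2 := by
    intro n
    refine le_trans ?_ (hφint n)
    rw [intervalIntegral.integral_of_le (by norm_num), ← integral_Icc_eq_integral_Ioc,
      ← integral_indicator measurableSet_Icc]
    exact integral_mono (hdi n) ((integrable_indicator_iff measurableSet_Icc).2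
      ((hc n).continuousOn.integrableOn_compact isCompact_Icc)) (hd_le n)
  have hanti : ∀ x, Antitone fun n => F n x := fun x =>
    antitone_nat_of_succ_le fun n => by rw [hFs]; linarith [hd0 n x]
  have hbdd : ∀ x, BddBelow (range fun n => F n x) := fun x =>
    ⟨0, by rintro _ ⟨n, rfl⟩; exact hF0 n x⟩
  have hlim : ∀ x, Tendsto (fun n => F n x) atTop (𝓝 (⨅ n, F n x)) := fun x =>
    tendsto_atTop_ciInf (hanti x) (hbdd x)
  have hf0 : ∀ x, 0 ≤ ⨅ n, F n x := fun x => le_ciInf fun n => hF0 n x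
  have hfb : ∀ x, ⨅ n, F n x ≤ b x := fun x => (ciInf_le (hbdd x) 0).trans (hFb 0 x)
  have hFsum : ∀ n, 2 - (1 - (1 / 2 : ℝ) ^ n) ≤ ∫ x, F n x := by
    intro n
    induction n with
    | zero => simpa [hFdef] using bint
    | succ n ih =>
      simp_rw [hFs]
      rw [integral_sub (hFi n) (hdi n)]
      have h2 : (12 : ℝ) * (1 / 4) ^ (n + 3) ^ 2 ≤ (1 / 2) ^ (n + 1) := by
        calc (12 : ℝ) * (1 / 4) ^ (n + 3) ^ 2 ≤ 12 * (1 / 4) ^ (n + 3) := by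
              gcongr 12 * ?_
              exact pow_le_pow_of_le_one (by norm_num) (by norm_num) (by nlinarith)
          _ ≤ 16 * (1 / 2) ^ (n + 5) := by
              rw [pow_add, pow_add]
              have : ((1 : ℝ) / 4) ^ n ≤ (1 / 2) ^ n := by gcongr; norm_num
              nlinarith [pow_pos (show (0 : ℝ) < 1 / 2 by norm_num) n]
          _ = (1 / 2) ^ (n + 1) := by rw [pow_add, pow_add]; ring
      have h3 : ((1 : ℝ) / 2) ^ n = (1 / 2) ^ (n + 1) + (1 / 2) ^ (n + 1) := by
        rw [pow_succ]; ring
      linarith [hd_int n]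
  refine ⟨fun x => ⨅ n, F n x, measurable_of_tendsto_metrizable (fun n => (hFc n).measurable)
    (tendsto_pi_nhds.2 hlim), hf0, fun x => (hfb x).trans (b1 x), fun x hx =>
    le_antisymm ((hfb x).trans (bs x hx).le) (hf0 x), fun n x hx => ?_, ?_, fun r hr1 hr2 => ?_⟩
  · refine le_antisymm ((ciInf_le (hbdd x) (n + 1)).trans ?_) (hf0 x)
    rw [hFs, hx]; simp
  · have := tendsto_integral_of_dominated_convergence (μ := volume) (F := F)
      (f := fun x => ⨅ n, F n x) b (fun n => (hFc n).aestronglyMeasurable) hbi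
      (fun n => ae_of_all _ fun x => by rw [Real.norm_of_nonneg (hF0 n x)]; exact hFb n x)
      (ae_of_all _ hlim)
    refine lt_of_lt_of_le one_pos (ge_of_tendsto' this fun n => ?_)
    have := pow_pos (show (0 : ℝ) < 1 / 2 by norm_num) n
    linarith [hFsum n]
  · set w : ℕ → ℝ → ℂ := fun n => cmFT volume fun x => (F n x : ℂ) with hw
    set d : ℕ → ℝ → ℂ := fun n => cmFT volume fun x => ((F n x * φ n x : ℝ) : ℂ) with hd
    have hwc : ∀ n, Continuous (w n) := fun n => continuous_cmFT (hFi n).ofReal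
    have hdwc : ∀ n, Continuous (d n) := fun n => continuous_cmFT (hdi n).ofReal
    have hrec : ∀ n, w (n + 1) = w n - d n := by
      intro n
      rw [hw, hd]
      simp only [hFs, Complex.ofReal_sub]
      exact cmFT_sub (hFi n).ofReal (hdi n).ofReal
    have hdw : ∀ n, ∫⁻ ξ, ‖d n ξ‖ₑ ≤ 3 * ∫⁻ ξ, ‖w n ξ‖ₑ := by
      intro n
      have := hF n (fun x => (F n x : ℂ)) (hFi n).ofReal
      simpa only [hd, hw, Complex.ofReal_mul] using this
    set A := (∫⁻ ξ, ‖w 0 ξ‖ₑ).toReal with hA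
    have hA0 : ∫⁻ ξ, ‖w 0 ξ‖ₑ = ENNReal.ofReal A := by
      rw [hA, ENNReal.ofReal_toReal]; simpa [hw, hFdef] using bF
    have hA' : 0 ≤ A := ENNReal.toReal_nonneg
    have hwn : ∀ n, ∫⁻ ξ, ‖w n ξ‖ₑ ≤ ENNReal.ofReal (4 ^ n * A) := by
      intro n
      induction n with
      | zero => simp [hA0]
      | succ n ih =>
        calc ∫⁻ ξ, ‖w (n + 1) ξ‖ₑ ≤ ∫⁻ ξ, (‖w n ξ‖ₑ + ‖d n ξ‖ₑ) := by
              rw [hrec]; exact lintegral_mono fun ξ => enorm_sub_le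
          _ = (∫⁻ ξ, ‖w n ξ‖ₑ) + ∫⁻ ξ, ‖d n ξ‖ₑ :=
              lintegral_add_left (hwc n).enorm.measurable _
          _ ≤ ENNReal.ofReal (4 ^ n * A) + 3 * ENNReal.ofReal (4 ^ n * A) := by
              exact add_le_add ih ((hdw n).trans (mul_le_mul_right ih 3))
          _ = ENNReal.ofReal (4 ^ (n + 1) * A) := by
              rw [show (3 : ENNReal) = ENNReal.ofReal 3 by simp, ← ENNReal.ofReal_mul (by norm_num),
                ← ENNReal.ofReal_add (by positivity) (by positivity)]
              congr 1; ring
    have hdn : ∀ n, ∫⁻ ξ, ‖d n ξ‖ₑ ≤ ENNReal.ofReal (3 * (4 ^ n * A)) := by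
      intro n
      rw [ENNReal.ofReal_mul (by norm_num), ENNReal.ofReal_ofNat]
      exact (hdw n).trans (by gcongr; exact hwn n)
    have hle1 : ∀ n x, F n x ≤ 1 := fun n x => (hFb n x).trans (b1 x)
    have hL1 : ∀ {g : ℝ → ℝ}, Integrable g → (∀ x, 0 ≤ g x) →
        ∫⁻ x, ‖((g x : ℝ) : ℂ)‖ₑ = ENNReal.ofReal (∫ x, g x) := by
      intro g hg hg0
      rw [ofReal_integral_eq_lintegral_ofReal hg (ae_of_all _ hg0)]
      congr 1; funext x
      rw [← ofReal_norm, Complex.norm_real, Real.norm_of_nonneg (hg0 x)]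
    have hr0 : 0 < r := by linarith
    have hrE : ENNReal.ofReal r ≠ 0 := by simpa using hr0
    have hnorm : ∀ g : ℝ → ℂ, eLpNorm g (ENNReal.ofReal r) volume =
        (∫⁻ ξ, ‖g ξ‖ₑ ^ r) ^ (1 / r) := by
      intro g
      rw [eLpNorm_eq_lintegral_rpow_enorm_toReal hrE ENNReal.ofReal_ne_top,
        ENNReal.toReal_ofReal hr0.le]
    have hdr : ∀ n, eLpNorm (d n) (ENNReal.ofReal r) volume ≤
        ENNReal.ofReal (((3 * (4 ^ n * A)) ^ (2 - r) *
          (12 * (1 / 4) ^ (n + 3) ^ 2) ^ (r - 1)) ^ (1 / r)) := by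
      intro n
      rw [hnorm, ← ENNReal.ofReal_rpow_of_nonneg (by positivity) (by positivity),
        ENNReal.ofReal_mul (by positivity),
        ← ENNReal.ofReal_rpow_of_nonneg (by positivity) (by linarith),
        ← ENNReal.ofReal_rpow_of_nonneg (by positivity) (by linarith)]
      refine ENNReal.rpow_le_rpow ?_ (by positivity)
      refine lintegral_enorm_cmFT_rpow_le (u := fun x => ((F n x * φ n x : ℝ) : ℂ))
        (Complex.continuous_ofReal.comp (hdc n))
        (hdi n).ofReal (fun x => ?_) ENNReal.ofReal_ne_top (hdn n) ?_ hr1 hr2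
      · rw [Complex.norm_real, Real.norm_of_nonneg (hd0 n x)]
        exact (hdF n x).trans (hle1 n x)
      · rw [hL1 (hdi n) (hd0 n)]
        exact ENNReal.ofReal_le_ofReal (hd_int n)
    have hfin : eLpNorm (cmFT volume fun x => ((⨅ n, F n x : ℝ) : ℂ)) (ENNReal.ofReal r)
        volume < ⊤ := by
      refine eLpNorm_lt_top_of_tendsto_of_tsum (by simpa using hr1.le)
        (fun n => (hwc n).aestronglyMeasurable) (fun n => (hdwc n).aestronglyMeasurable) hrec
        ?_ ?_ (tendsto_cmFT_of_dominated (fun n => (hFi n).ofReal) hbi (fun n x => ?_) fun x => ?_)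
      · rw [hnorm]
        refine ENNReal.rpow_ne_top_of_nonneg (by positivity) (ne_top_of_le_ne_top ?_
          (lintegral_enorm_cmFT_rpow_le (u := fun x => (F 0 x : ℂ))
            (Complex.continuous_ofReal.comp (hFc 0))
            (hFi 0).ofReal (fun x => ?_) ENNReal.ofReal_ne_top hA0.le
            (hL1 (hFi 0) (hF0 0)).le hr1 hr2))
        · exact ENNReal.mul_ne_top
            (ENNReal.rpow_ne_top_of_nonneg (by linarith) ENNReal.ofReal_ne_top)
            (ENNReal.rpow_ne_top_of_nonneg (by linarith) ENNReal.ofReal_ne_top)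
        · rw [Complex.norm_real, Real.norm_of_nonneg (hF0 0 x)]
          exact hle1 0 x
      · exact ne_top_of_le_ne_top (summable_interpolated hA' hr1).tsum_ofReal_ne_top
          (ENNReal.tsum_le_tsum hdr)
      · rw [Complex.norm_real, Real.norm_of_nonneg (hF0 n x)]
        exact hFb n x
      · exact (Complex.continuous_ofReal.tendsto _).comp (hlim x)
    rw [hnorm] at hfin
    exact (ENNReal.rpow_lt_top_iff_of_pos (by positivity)).1 hfin

theorem lintegral_norm_rpow_lt_top {w : ℝ → ℂ} {C : ℝ} (hC : 0 ≤ C) (hw : ∀ ξ, ‖w ξ‖ ≤ C)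
    (h : ∀ r : ℝ, 1 < r → r < 2 → ∫⁻ ξ, ‖w ξ‖ₑ ^ r < ⊤) {r : ℝ} (hr : 1 < r) :
    ∫⁻ ξ, ENNReal.ofReal (‖w ξ‖ ^ r) < ⊤ := by
  have e : ∀ ξ, ∀ s : ℝ, 0 ≤ s → ENNReal.ofReal (‖w ξ‖ ^ s) = ‖w ξ‖ₑ ^ s := by
    intro ξ s hs
    rw [← ENNReal.ofReal_rpow_of_nonneg (norm_nonneg _) hs, ofReal_norm]
  rcases lt_or_ge r 2 with h2 | h2
  · simpa only [e _ r (by linarith)] using h r hr h2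
  · calc ∫⁻ ξ, ENNReal.ofReal (‖w ξ‖ ^ r)
        ≤ ∫⁻ ξ, ENNReal.ofReal (C ^ (r - 3 / 2)) * ‖w ξ‖ₑ ^ (3 / 2 : ℝ) := by
          refine lintegral_mono fun ξ => ?_
          rw [← e ξ _ (by norm_num), ← ENNReal.ofReal_mul (by positivity)]
          refine ENNReal.ofReal_le_ofReal ?_
          calc ‖w ξ‖ ^ r = ‖w ξ‖ ^ (r - 3 / 2) * ‖w ξ‖ ^ (3 / 2 : ℝ) := by
                rw [← Real.rpow_add_of_nonneg (norm_nonneg _) (by linarith) (by norm_num)]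
                congr 1; ring
            _ ≤ _ := by
                gcongr
                · linarith
                · exact hw ξ
      _ = ENNReal.ofReal (C ^ (r - 3 / 2)) * ∫⁻ ξ, ‖w ξ‖ₑ ^ (3 / 2 : ℝ) :=
          lintegral_const_mul' _ _ ENNReal.ofReal_ne_top
      _ < ⊤ := ENNReal.mul_lt_top ENNReal.ofReal_lt_top (h _ (by norm_num) (by norm_num))

theorem mFT_withDensity {f : ℝ → ℝ} (hf : Measurable f) (h0 : ∀ x, 0 ≤ f x) (ξ : ℝ) :
    mFT (volume.withDensity fun x => ENNReal.ofReal (f x)) ξ =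
      cmFT volume (fun x => (f x : ℂ)) ξ := by
  unfold mFT cmFT
  rw [integral_withDensity_eq_integral_toReal_smul hf.ennreal_ofReal
    (ae_of_all _ fun x => ENNReal.ofReal_lt_top)]
  congr 1; funext x
  rw [ENNReal.toReal_ofReal (h0 x), Complex.real_smul, mul_comm]

theorem exists_measure_of_density {E : Set ℝ} {f : ℝ → ℝ} (hm : Measurable f)
    (h0 : ∀ x, 0 ≤ f x) (hi : Integrable f) (hpos : 0 < ∫ x, f x) (hE : ∀ x, x ∉ E → f x = 0)
    (hEm : MeasurableSet E)
    (h : ∀ r : ℝ, 1 < r → r < 2 → ∫⁻ ξ, ‖cmFT volume (fun x => (f x : ℂ)) ξ‖ₑ ^ r < ⊤) :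
    0 < volume E ∧ ∃ μ : Measure ℝ, IsFiniteMeasure μ ∧ μ ≠ 0 ∧ μ Eᶜ = 0 ∧
      ∀ r : ℝ, 1 < r → (∫⁻ ξ : ℝ, ENNReal.ofReal (‖mFT μ ξ‖ ^ r)) < ⊤ := by
  set μ := volume.withDensity fun x => ENNReal.ofReal (f x) with hμ
  have huniv : μ univ = ENNReal.ofReal (∫ x, f x) := by
    rw [hμ, withDensity_apply _ MeasurableSet.univ, Measure.restrict_univ,
      ofReal_integral_eq_lintegral_ofReal hi (ae_of_all _ h0)]
  have hcompl : μ Eᶜ = 0 := by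
    rw [hμ, withDensity_apply _ hEm.compl]
    exact setLIntegral_eq_zero hEm.compl fun x hx => by simp [hE x hx]
  have hne : μ ≠ 0 := by
    intro hz
    rw [hz] at huniv
    simp at huniv
    linarith
  refine ⟨pos_iff_ne_zero.2 fun hz => hne ?_, μ, ⟨by rw [huniv]; exact ENNReal.ofReal_lt_top⟩,
    hne, hcompl, fun r hr => ?_⟩
  · rw [← Measure.measure_univ_eq_zero, ← union_compl_self E]
    exact measure_union_null (withDensity_absolutelyContinuous _ _ hz) hcompl
  · simp only [hμ, mFT_withDensity hm h0]
    exact lintegral_norm_rpow_lt_top (C := ∫ x, ‖(f x : ℂ)‖)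
      (integral_nonneg fun x => norm_nonneg _) (norm_cmFT_le _ _) h hr

theorem exists_frequency {Ω : ℝ → ℝ} (hΩ : Tendsto Ω atTop (𝓝 0)) (n : ℕ) {M ε : ℝ} (hε : 0 < ε) :
    ∃ N : ℕ, n + 1 ≤ N ∧ M * Ω (N / 2) ≤ ε := by
  have h : Tendsto (fun N : ℕ => M * Ω (N / 2)) atTop (𝓝 0) := by
    simpa using (hΩ.comp (tendsto_natCast_atTop_atTop.atTop_div_const
      (by norm_num : (0 : ℝ) < 2))).const_mul M
  obtain ⟨N, h1, h2⟩ := ((eventually_ge_atTop (n + 1)).and (h.eventually_le_const hε)).exists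
  exact ⟨N, h1, h2⟩

theorem isCompact_avoiding {δ : ℕ → ℝ} {N : ℕ → ℕ} :
    IsCompact (Icc (-2 : ℝ) 2 ∩ {x | ∀ n, ∀ k : ℤ, δ n ≤ |N n * x - k|}) := by
  refine isCompact_Icc.inter_right ?_
  simp only [Set.ofPred_forall]
  exact isClosed_iInter fun n => isClosed_iInter fun k =>
    isClosed_le continuous_const (by fun_prop)

theorem stmt_15 (Ω : ℝ → ℝ) (hΩpos : ∀ t, 0 ≤ t → 0 < Ω t)
    (hΩanti : ∀ s t, 0 ≤ s → s ≤ t → Ω t ≤ Ω s)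
    (hΩlim : Tendsto Ω atTop (𝓝 0))
    (C₀ : ℝ) (hC₀ : ∀ t : ℝ, 0 < t → Ω (t / 2) ≤ C₀ * Ω t) :
    ∃ E : Set ℝ, IsCompact E ∧ 0 < volume E ∧
      -- (i) a nonzero positive finite Borel measure supported in `E` with
      -- `∫_ℝ |μ̂(ξ)|^r dξ < ∞` for every `r > 1`
      (∃ μ : Measure ℝ, IsFiniteMeasure μ ∧ μ ≠ 0 ∧ μ Eᶜ = 0 ∧
        ∀ r : ℝ, 1 < r → (∫⁻ ξ : ℝ, ENNReal.ofReal (‖mFT μ ξ‖ ^ r)) < ⊤) ∧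
      -- (ii) every finite complex Borel measure `g dν` supported in `E` with
      -- `|ν̂(ξ)| ≤ Ω(ξ)` for all `ξ > 0` vanishes
      (∀ (ν : Measure ℝ), IsFiniteMeasure ν → ∀ g : ℝ → ℂ,
        Integrable g ν → (∀ᵐ x ∂ν, x ∉ E → g x = 0) →
        (∀ ξ : ℝ, 0 < ξ → ‖cmFT ν g ξ‖ ≤ Ω ξ) →
        g =ᵐ[ν] 0) := by
  set δ : ℕ → ℝ := fun n => (1 / 4) ^ (n + 3) ^ 2 with hδ
  have hδ0 : ∀ n, 0 < δ n := fun n => by positivity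
  have hδ1 : ∀ n, δ n ≤ 1 / 4 := fun n =>
    pow_le_of_le_one (by norm_num) (by norm_num) (by positivity)
  choose K c hc0 hc using fun n : ℕ =>
    exists_analytic_poly_small (η := 4 * δ n) (ε := 1 / ((n : ℝ) + 1))
      (by linarith [hδ0 n]) (by positivity)
  choose N hNn hN using fun n : ℕ =>
    exists_frequency hΩlim n (M := ∑ k ∈ Finset.range (K n + 1), ‖c n k‖)
      (ε := 1 / ((n : ℝ) + 1)) (by positivity)
  choose a ha0 has hasum ha_nonneg ha_le ha_one using fun n => exists_trapezoid (hδ0 n) (hδ1 n)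
  set E : Set ℝ := Icc (-2 : ℝ) 2 ∩ {x | ∀ n, ∀ k : ℤ, δ n ≤ |N n * x - k|} with hE
  have hEc : IsCompact E := isCompact_avoiding
  obtain ⟨f, fm, f0, f1, fs, fz, fpos, fr⟩ := exists_infinite_product_density
    (φ := fun n x => ∑' m : ℕ, a n m * Real.cos (2 * Real.pi * m * (N n * x)))
    (fun n => (continuous_cosSeries (has n)).comp (continuous_const.mul continuous_id))
    (fun n x => ha_nonneg n _) (fun n x => ha_le n _)
    (fun n => by
      rw [integral_cosSeries (has n) (by have := hNn n; omega), ha0]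
      simp only [hδ]; linarith)
    (fun n u hu => by
      refine (lintegral_enorm_cmFT_mul_cosSeries_le hu (has n) (N n)).trans ?_
      gcongr
      exact (ENNReal.ofReal_le_ofReal (hasum n)).trans (by simp))
  have fi : Integrable f := by
    have : IntegrableOn f (Icc (-2) 2) := Measure.integrableOn_of_bounded (M := 1)
      (by simp) fm.aestronglyMeasurable (ae_of_all _ fun x => by
        rw [Real.norm_of_nonneg (f0 x)]; exact f1 x)
    exact this.integrable_of_forall_notMem_eq_zero fs
  have fE : ∀ x, x ∉ E → f x = 0 := by
    intro x hx
    by_cases hx2 : x ∈ Icc (-2 : ℝ) 2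
    · have : ¬ ∀ n, ∀ k : ℤ, δ n ≤ |N n * x - k| := fun h => hx ⟨hx2, h⟩
      push Not at this
      obtain ⟨n, k, hk⟩ := this
      exact fz n x (ha_one n _ k hk)
    · exact fs x hx2
  obtain ⟨hvol, hμ⟩ := exists_measure_of_density fm f0 fi fpos fE hEc.measurableSet fr
  refine ⟨E, hEc, hvol, hμ, fun ν hν g hg hgE hgΩ => ae_eq_zero_of_cmFT_eq_zero hg fun ξ => ?_⟩
  have hbound : ∀ᶠ n : ℕ in atTop,
      ‖cmFT ν g ξ‖ ≤ 1 / ((n : ℝ) + 1) * ∫ x, ‖g x‖ ∂ν + 1 / ((n : ℝ) + 1) := by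
    filter_upwards [tendsto_natCast_atTop_atTop.eventually_ge_atTop (2 * |ξ|)] with n hn
    have hNr : (n : ℝ) + 1 ≤ N n := by exact_mod_cast hNn n
    refine (norm_cmFT_le_of_poly hg (hc0 n) (N := N n) (ε := 1 / ((n : ℝ) + 1))
      (B := Ω (N n / 2)) ?_ fun k hk => ?_).trans (add_le_add le_rfl (hN n))
    · filter_upwards [hgE] with x hx hgx
      have hxE : x ∈ E := by_contra fun h => hgx (hx h)
      refine hc n _ ?_ (four_mul_dist_le_norm_exp_sub_one fun k => hxE.2 n k)
      rw [← neg_mul, ← Complex.ofReal_neg, Complex.norm_exp_ofReal_mul_I]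
    · have hk' : (1 : ℝ) ≤ k := by exact_mod_cast hk
      have h1 : (N n : ℝ) / 2 ≤ ξ + k * N n := by nlinarith [neg_abs_le ξ]
      have h2 : (0 : ℝ) < N n / 2 := by linarith [Nat.cast_nonneg (α := ℝ) n]
      exact (hgΩ _ (by linarith)).trans (hΩanti _ _ h2.le h1)
  have hlim : Tendsto (fun n : ℕ => 1 / ((n : ℝ) + 1) * ∫ x, ‖g x‖ ∂ν + 1 / ((n : ℝ) + 1))
      atTop (𝓝 0) := by
    simpa using (tendsto_one_div_add_atTop_nhds_zero_nat (𝕜 := ℝ)).mul_const (∫ x, ‖g x‖ ∂ν)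
      |>.add (tendsto_one_div_add_atTop_nhds_zero_nat (𝕜 := ℝ))
  exact norm_le_zero_iff.1 (ge_of_tendsto hlim hbound)
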